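/- (New 4-variable non-Shannon-type inequality obtained by projecting the 7-variable cone H₇ ∩ C₇.) For any four jointly distributed discrete random variables X₁, X₂, X₃, X₄ with finite entropies: −56·H(1) − 4·H(2) − 19·H(3) + 45·H(12) + 67·H(13) + 22·H(23) + 23·H(14) − 8·H(24) + 9·H(34) − 55·H(123) − 24·H(134) ≥ 0. -/

import Mathlib

open MeasureTheory

/-- The Shannon entropy of a random variable `X` taking values in a finite set,
computed from the distribution of `X` under the measure `μ`. -/
noncomputable def shannonEntropy {Ω : Type*} [MeasurableSpace Ω] (μ : Measure Ω)
    {β : Type*} [Fintype β] (X : Ω → β) : ℝ :=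
  ∑ b : β, Real.negMulLog ((μ (X ⁻¹' {b})).toReal)

section WeightedEntropy

open Finset
open scoped Classical

/-- The total weight of the fibre of `f` through `a`. -/
noncomputable def fiberMass {Ω β : Type*} [Fintype Ω] (w : Ω → ℝ) (f : Ω → β) (a : Ω) : ℝ :=
  ∑ b, if f b = f a then w b else 0

/-- The entropy of a function on a finite weighted set; it depends only on the partition into
fibres. -/
noncomputable def weightedEntropy {Ω β : Type*} [Fintype Ω] (w : Ω → ℝ) (f : Ω → β) : ℝ :=
  -∑ a, w a * Real.log (fiberMass w f a)

theorem shannonEntropy_comp {Ω β γ : Type*} [MeasurableSpace Ω] (μ : Measure Ω)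
    [IsProbabilityMeasure μ] [Fintype β] [MeasurableSpace β] [MeasurableSingletonClass β]
    [Fintype γ] {Y : Ω → β} (hY : Measurable Y) (f : β → γ) :
    shannonEntropy μ (fun ω => f (Y ω)) = weightedEntropy (fun b => (μ (Y ⁻¹' {b})).toReal) f := by
  have hmass (c : γ) : (μ ((fun ω => f (Y ω)) ⁻¹' {c})).toReal =
      ∑ b, if f b = c then (μ (Y ⁻¹' {b})).toReal else 0 := by
    have hset : (fun ω => f (Y ω)) ⁻¹' {c} = Y ⁻¹' ↑({b | f b = c} : Finset β) := by
      ext ω; simp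
    rw [hset, ← sum_measure_preimage_singleton _ fun b _ => hY (measurableSet_singleton b),
      ENNReal.toReal_sum fun b _ => measure_ne_top _ _, sum_filter]
  simp only [shannonEntropy, weightedEntropy, Real.negMulLog, hmass, fiberMass]
  simp only [neg_mul, sum_neg_distrib, sum_mul]
  rw [sum_comm]
  congr 1
  refine sum_congr rfl fun b _ => ?_
  simp only [ite_mul, zero_mul, sum_ite_eq, mem_univ, if_true]

variable {Ω β γ δ ε : Type*} [Fintype Ω] {w : Ω → ℝ}

theorem fiberMass_pos (hw : ∀ a, 0 ≤ w a) (f : Ω → β) {a : Ω} (ha : w a ≠ 0) :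
    0 < fiberMass w f a := by
  refine sum_pos' (fun b _ => ?_) ⟨a, mem_univ a, ?_⟩
  · split_ifs
    exacts [hw b, le_rfl]
  · simpa using (hw a).lt_of_ne' ha

theorem fiberMass_congr {f : Ω → β} {a b : Ω} (h : f a = f b) :
    fiberMass w f a = fiberMass w f b := by
  simp [fiberMass, h]

theorem weightedEntropy_congr {f : Ω → β} {g : Ω → γ}
    (h : ∀ a b, w a ≠ 0 → w b ≠ 0 → (f a = f b ↔ g a = g b)) :
    weightedEntropy w f = weightedEntropy w g := by
  unfold weightedEntropy
  congr 1
  refine sum_congr rfl fun a _ => ?_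
  rcases eq_or_ne (w a) 0 with ha | ha
  · simp [ha]
  · have : fiberMass w f a = fiberMass w g a := by
      refine sum_congr rfl fun b _ => ?_
      rcases eq_or_ne (w b) 0 with hb | hb
      · simp [hb]
      · simp [h b a hb ha]
    rw [this]

theorem sum_div_fiberMass_le (w : Ω → ℝ) (f : Ω → β) (c : β) :
    ∑ a, (if f a = c then w a / fiberMass w f a else 0) ≤ 1 := by
  have hmass : ∀ a, (if f a = c then w a / fiberMass w f a else 0) =
      (if f a = c then w a else 0) / ∑ b, if f b = c then w b else 0 := by
    intro a
    split_ifs with ha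
    · simp [fiberMass, ha]
    · simp
  rw [sum_congr rfl fun a _ => hmass a, ← sum_div]
  exact div_self_le_one _

theorem sum_ratio_le (hw : ∀ a, 0 ≤ w a) {f : Ω → β} {g : Ω → γ} {k : Ω → δ} {u : Ω → ε}
    (hu : ∀ a b, u a = u b ↔ f a = f b ∧ g a = g b)
    (hf : ∀ a b, f a = f b → k a = k b) (hg : ∀ a b, g a = g b → k a = k b) :
    ∑ a, w a * (fiberMass w f a * fiberMass w g a / (fiberMass w u a * fiberMass w k a)) ≤
      ∑ a, w a := by
  have hnn (a b : Ω) : 0 ≤ if k b = k a then w a * w b / fiberMass w k a else 0 := by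
    split_ifs
    · exact div_nonneg (mul_nonneg (hw a) (hw b))
        (sum_nonneg fun b _ => by split_ifs; exacts [hw b, le_rfl])
    · exact le_rfl
  calc
    _ = ∑ a, ∑ x, ∑ y, if f x = f a ∧ g y = g a then
          w x * w y / fiberMass w k x * (w a / fiberMass w u a) else 0 := by
      refine sum_congr rfl fun a _ => ?_
      have h1 : w a * (fiberMass w f a * fiberMass w g a /
          (fiberMass w u a * fiberMass w k a)) =
          (fiberMass w f a * fiberMass w g a) * (w a / (fiberMass w u a * fiberMass w k a)) := by
        ring
      rw [h1]
      nth_rewrite 1 [fiberMass]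
      nth_rewrite 1 [fiberMass]
      rw [sum_mul_sum, sum_mul]
      refine sum_congr rfl fun x _ => ?_
      rw [sum_mul]
      refine sum_congr rfl fun y _ => ?_
      by_cases hx : f x = f a
      · by_cases hy : g y = g a
        · rw [fiberMass_congr (hf x a hx)]
          simp only [hx, hy, if_true, and_self]
          ring
        · simp [hy]
      · simp [hx]
    _ = ∑ x, ∑ y, ∑ a, if f x = f a ∧ g y = g a then
          w x * w y / fiberMass w k x * (w a / fiberMass w u a) else 0 := by
      rw [sum_comm]
      exact sum_congr rfl fun x _ => sum_comm
    _ ≤ ∑ x, ∑ y, if k y = k x then w x * w y / fiberMass w k x else 0 := by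
      refine sum_le_sum fun x _ => sum_le_sum fun y _ => ?_
      by_cases hex : ∃ c, f x = f c ∧ g y = g c
      · obtain ⟨c, hxc, hyc⟩ := hex
        have hk : k y = k x := (hg y c hyc).trans (hf x c hxc).symm
        have hterm : ∀ a, (if f x = f a ∧ g y = g a then
            w x * w y / fiberMass w k x * (w a / fiberMass w u a) else 0) =
            w x * w y / fiberMass w k x *
              (if u a = u c then w a / fiberMass w u a else 0) := by
          intro a
          have : (f x = f a ∧ g y = g a) ↔ u a = u c := by
            rw [hu, hxc, hyc, eq_comm, eq_comm (a := g c)]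
          simp [this]
        rw [sum_congr rfl fun a _ => hterm a, ← mul_sum]
        have := hnn x y
        rw [if_pos hk] at this ⊢
        exact mul_le_of_le_one_right this (sum_div_fiberMass_le w u (u c))
      · rw [sum_eq_zero fun a _ => if_neg fun h => hex ⟨a, h⟩]
        exact hnn x y
    _ = ∑ x, w x := by
      refine sum_congr rfl fun x _ => ?_
      have hterm : ∀ y, (if k y = k x then w x * w y / fiberMass w k x else 0) =
          w x / fiberMass w k x * if k y = k x then w y else 0 := by
        intro y
        split_ifs <;> ring
      rw [sum_congr rfl fun y _ => hterm y, ← mul_sum]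
      change w x / fiberMass w k x * fiberMass w k x = w x
      rcases eq_or_ne (w x) 0 with hx | hx
      · simp [hx]
      · exact div_mul_cancel₀ _ (fiberMass_pos hw k hx).ne'

theorem weightedEntropy_submodular (hw : ∀ a, 0 ≤ w a)
    {f : Ω → β} {g : Ω → γ} {k : Ω → δ} {u : Ω → ε}
    (hu : ∀ a b, u a = u b ↔ f a = f b ∧ g a = g b)
    (hf : ∀ a b, f a = f b → k a = k b) (hg : ∀ a b, g a = g b → k a = k b) :
    weightedEntropy w u + weightedEntropy w k ≤ weightedEntropy w f + weightedEntropy w g := by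
  have hterm (a : Ω) : w a * Real.log (fiberMass w f a) + w a * Real.log (fiberMass w g a) -
      w a * Real.log (fiberMass w u a) - w a * Real.log (fiberMass w k a) ≤
      w a * (fiberMass w f a * fiberMass w g a / (fiberMass w u a * fiberMass w k a)) - w a := by
    rcases eq_or_ne (w a) 0 with ha | ha
    · simp [ha]
    · have pf := fiberMass_pos hw f ha
      have pg := fiberMass_pos hw g ha
      have pu := fiberMass_pos hw u ha
      have pk := fiberMass_pos hw k ha
      have hlog := Real.log_le_sub_one_of_pos (div_pos (mul_pos pf pg) (mul_pos pu pk))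
      rw [Real.log_div (mul_pos pf pg).ne' (mul_pos pu pk).ne', Real.log_mul pf.ne' pg.ne',
        Real.log_mul pu.ne' pk.ne'] at hlog
      linarith [mul_le_mul_of_nonneg_left hlog (hw a)]
  have hsum := sum_le_sum fun a (_ : a ∈ univ) => hterm a
  simp only [sum_sub_distrib, sum_add_distrib] at hsum
  unfold weightedEntropy
  linarith [sum_ratio_le hw hu hf hg]

/-- The weight on pairs whose two coordinates are conditionally independent copies of `w`
over `t`. -/
noncomputable def copyWeight (w : Ω → ℝ) (t : Ω → β) (p : Ω × Ω) : ℝ :=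
  if t p.2 = t p.1 then w p.1 * w p.2 / fiberMass w t p.1 else 0

theorem copyWeight_nonneg (hw : ∀ a, 0 ≤ w a) (t : Ω → β) (p : Ω × Ω) :
    0 ≤ copyWeight w t p := by
  unfold copyWeight
  split_ifs
  · exact div_nonneg (mul_nonneg (hw _) (hw _))
      (sum_nonneg fun b _ => by split_ifs; exacts [hw b, le_rfl])
  · exact le_rfl

theorem copyWeight_ne_zero {t : Ω → β} {p : Ω × Ω} (h : copyWeight w t p ≠ 0) :
    t p.2 = t p.1 ∧ w p.1 ≠ 0 ∧ w p.2 ≠ 0 := by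
  unfold copyWeight at h
  split_ifs at h with ht
  · refine ⟨ht, ?_, ?_⟩ <;> rintro h0 <;> simp [h0] at h
  · exact absurd rfl h

theorem copyWeight_swap (w : Ω → ℝ) (t : Ω → β) (a b : Ω) :
    copyWeight w t (a, b) = copyWeight w t (b, a) := by
  unfold copyWeight
  by_cases h : t b = t a
  · simp only [h, if_true, fiberMass_congr h, mul_comm]
  · simp [h, Ne.symm h]

theorem sum_copyWeight_snd (hw : ∀ a, 0 ≤ w a) (t : Ω → β) (a : Ω) :
    ∑ b, copyWeight w t (a, b) = w a := by
  have hterm : ∀ b, copyWeight w t (a, b) =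
      w a / fiberMass w t a * if t b = t a then w b else 0 := by
    intro b
    unfold copyWeight
    split_ifs <;> ring
  rw [sum_congr rfl fun b _ => hterm b, ← mul_sum]
  change w a / fiberMass w t a * fiberMass w t a = w a
  rcases eq_or_ne (w a) 0 with ha | ha
  · simp [ha]
  · exact div_mul_cancel₀ _ (fiberMass_pos hw t ha).ne'

theorem sum_copyWeight_fst (hw : ∀ a, 0 ≤ w a) (t : Ω → β) (b : Ω) :
    ∑ a, copyWeight w t (a, b) = w b := by
  simp_rw [copyWeight_swap w t _ b]
  exact sum_copyWeight_snd hw t b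

theorem sum_copyWeight_mul_fst (hw : ∀ a, 0 ≤ w a) (t : Ω → β) (φ : Ω → ℝ) :
    ∑ p, copyWeight w t p * φ p.1 = ∑ a, w a * φ a := by
  rw [Fintype.sum_prod_type]
  simp_rw [← sum_mul, sum_copyWeight_snd hw]

theorem sum_copyWeight_mul_snd (hw : ∀ a, 0 ≤ w a) (t : Ω → β) (φ : Ω → ℝ) :
    ∑ p, copyWeight w t p * φ p.2 = ∑ a, w a * φ a := by
  rw [Fintype.sum_prod_type_right]
  simp_rw [← sum_mul, sum_copyWeight_fst hw]

theorem weightedEntropy_copyWeight_fst (hw : ∀ a, 0 ≤ w a) (t : Ω → β) (f : Ω → γ) :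
    weightedEntropy (copyWeight w t) (fun p => f p.1) = weightedEntropy w f := by
  have hmass (p : Ω × Ω) :
      fiberMass (copyWeight w t) (fun p => f p.1) p = fiberMass w f p.1 := by
    have := sum_copyWeight_mul_fst hw t fun a => if f a = f p.1 then (1 : ℝ) else 0
    simpa only [fiberMass, mul_ite, mul_one, mul_zero] using this
  simp only [weightedEntropy, hmass]
  rw [sum_copyWeight_mul_fst hw t fun a => Real.log (fiberMass w f a)]

theorem weightedEntropy_copyWeight_snd (hw : ∀ a, 0 ≤ w a) (t : Ω → β) (f : Ω → γ) :
    weightedEntropy (copyWeight w t) (fun p => f p.2) = weightedEntropy w f := by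
  have hmass (p : Ω × Ω) :
      fiberMass (copyWeight w t) (fun p => f p.2) p = fiberMass w f p.2 := by
    have := sum_copyWeight_mul_snd hw t fun a => if f a = f p.2 then (1 : ℝ) else 0
    simpa only [fiberMass, mul_ite, mul_one, mul_zero] using this
  simp only [weightedEntropy, hmass]
  rw [sum_copyWeight_mul_snd hw t fun a => Real.log (fiberMass w f a)]

theorem fiberMass_copyWeight_pair {t : Ω → β} {f : Ω → γ} {g : Ω → δ}
    (hf : ∀ a b, f a = f b → t a = t b) (hg : ∀ a b, g a = g b → t a = t b)
    {a b : Ω} (hab : t b = t a) :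
    fiberMass (copyWeight w t) (fun p => (f p.1, g p.2)) (a, b) =
      fiberMass w f a * fiberMass w g b / fiberMass w t a := by
  rw [fiberMass, Fintype.sum_prod_type]
  nth_rewrite 1 [fiberMass]
  nth_rewrite 1 [fiberMass]
  rw [sum_mul_sum, sum_div]
  refine sum_congr rfl fun x _ => ?_
  rw [sum_div]
  refine sum_congr rfl fun y _ => ?_
  by_cases hx : f x = f a
  · by_cases hy : g y = g b
    · have hxy : t y = t x := (hg y b hy).trans (hab.trans (hf x a hx).symm)
      simp [hx, hy, copyWeight, hxy, fiberMass_congr (hf x a hx)]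
    · simp [hy]
  · simp [hx]

theorem weightedEntropy_copyWeight_pair (hw : ∀ a, 0 ≤ w a) {t : Ω → β} {f : Ω → γ} {g : Ω → δ}
    (hf : ∀ a b, f a = f b → t a = t b) (hg : ∀ a b, g a = g b → t a = t b) :
    weightedEntropy (copyWeight w t) (fun p => (f p.1, g p.2)) =
      weightedEntropy w f + weightedEntropy w g - weightedEntropy w t := by
  have hterm (p : Ω × Ω) : copyWeight w t p *
      Real.log (fiberMass (copyWeight w t) (fun p => (f p.1, g p.2)) p) =
      copyWeight w t p * Real.log (fiberMass w f p.1) +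
        copyWeight w t p * Real.log (fiberMass w g p.2) -
        copyWeight w t p * Real.log (fiberMass w t p.1) := by
    rcases eq_or_ne (copyWeight w t p) 0 with hp | hp
    · simp [hp]
    · obtain ⟨ht, h1, h2⟩ := copyWeight_ne_zero hp
      have pf := (fiberMass_pos hw f h1).ne'
      have pg := (fiberMass_pos hw g h2).ne'
      have pt := (fiberMass_pos hw t h1).ne'
      rw [show p = (p.1, p.2) from rfl, fiberMass_copyWeight_pair hf hg ht,
        Real.log_div (mul_ne_zero pf pg) pt, Real.log_mul pf pg]
      ring
  unfold weightedEntropy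
  rw [sum_congr rfl fun p _ => hterm p, sum_sub_distrib, sum_add_distrib,
    sum_copyWeight_mul_fst hw t fun a => Real.log (fiberMass w f a),
    sum_copyWeight_mul_snd hw t fun a => Real.log (fiberMass w g a),
    sum_copyWeight_mul_fst hw t fun a => Real.log (fiberMass w t a)]
  ring

theorem shannonEntropy_comp_eq_of_iff {Ω β γ ι δ : Type*} [MeasurableSpace Ω] (μ : Measure Ω)
    [IsProbabilityMeasure μ] [Fintype β] [MeasurableSpace β] [MeasurableSingletonClass β]
    [Fintype γ] {Y : Ω → β} (hY : Measurable Y) (X : ι → β → δ) (S : Finset ι) (f : β → γ)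
    (hf : ∀ x y, f x = f y ↔ ∀ i ∈ S, X i x = X i y) :
    shannonEntropy μ (fun ω => f (Y ω)) =
      weightedEntropy (fun b => (μ (Y ⁻¹' {b})).toReal) fun b (i : S) => X i b := by
  rw [shannonEntropy_comp μ hY f]
  refine weightedEntropy_congr fun x y _ _ => ?_
  simp only [hf, funext_iff, Subtype.forall]

end WeightedEntropy

section EntropicFunctions

open Finset

/-- `h` is the joint entropy function of a sequence of random variables on a finite weighted
set. -/
def IsEntropic.{u} (h : Finset ℕ → ℝ) : Prop :=
  ∃ (Ω : Type u) (_ : Fintype Ω) (w : Ω → ℝ) (X : ℕ → Ω → ℕ), (∀ a, 0 ≤ w a) ∧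
    ∀ S : Finset ℕ, h S = weightedEntropy w fun a (i : S) => X i a

/-- The variable `n` is a copy of the variable `i` over `T`, conditionally independent of the
variables below `n`. -/
structure IsCopy (h : Finset ℕ → ℝ) (n i : ℕ) (T : Finset ℕ) : Prop where
  same : ∀ S, S ⊆ T → h (insert n S) = h (insert i S)
  indep : ∀ R, T ⊆ R → R ⊆ range n → h (insert n R) + h T = h R + h (insert i T)

theorem IsCopy.congr {h h' : Finset ℕ → ℝ} {n i m : ℕ} {T : Finset ℕ} (H : IsCopy h n i T)
    (hn : n < m) (hi : i < m) (hT : T ⊆ range m) (hh : ∀ S, S ⊆ range m → h' S = h S) :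
    IsCopy h' n i T where
  same S hS := by
    rw [hh _ (insert_subset (mem_range.2 hn) (hS.trans hT)),
      hh _ (insert_subset (mem_range.2 hi) (hS.trans hT)), H.same S hS]
  indep R hTR hR := by
    have hRm : R ⊆ range m := hR.trans (range_subset_range.2 hn.le)
    rw [hh _ (insert_subset (mem_range.2 hn) hRm), hh _ hT, hh _ hRm,
      hh _ (insert_subset (mem_range.2 hi) hT), H.indep R hTR hR]

theorem IsCopy.eq_of_subset {h : Finset ℕ → ℝ} {n i : ℕ} {T : Finset ℕ} (H : IsCopy h n i T)
    (S : Finset ℕ) {A B : Finset ℕ} (hS : S ⊆ T) (hA : insert n S = A) (hB : insert i S = B) :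
    h A = h B := by
  rw [← hA, ← hB, H.same S hS]

theorem IsCopy.add_eq_add {h : Finset ℕ → ℝ} {n i : ℕ} {T : Finset ℕ} (H : IsCopy h n i T)
    (R : Finset ℕ) {A B : Finset ℕ} (hTR : T ⊆ R) (hR : R ⊆ range n) (hA : insert n R = A)
    (hB : insert i T = B) : h A + h T = h R + h B := by
  rw [← hA, ← hB, H.indep R hTR hR]

theorem IsEntropic.submodular.{u} {h : Finset ℕ → ℝ} (H : IsEntropic.{u} h) (A B : Finset ℕ)
    {U I : Finset ℕ} (hU : A ∪ B = U) (hI : A ∩ B = I) : h U + h I ≤ h A + h B := by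
  obtain ⟨Ω, _, w, X, hw, hX⟩ := H
  subst hU hI
  simp only [hX]
  refine weightedEntropy_submodular hw ?_ ?_ ?_
  · intro a b
    simp only [funext_iff, Subtype.forall, mem_union]
    grind
  · intro a b
    simp only [funext_iff, Subtype.forall, mem_inter]
    grind
  · intro a b
    simp only [funext_iff, Subtype.forall, mem_inter]
    grind

theorem IsEntropic.exists_copy.{u} {h : Finset ℕ → ℝ} (H : IsEntropic.{u} h) (n i : ℕ)
    (T : Finset ℕ)
    (hi : i < n) (hT : T ⊆ range n) :
    ∃ h' : Finset ℕ → ℝ, IsEntropic.{u} h' ∧ (∀ S, S ⊆ range n → h' S = h S) ∧ IsCopy h' n i T := by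
  obtain ⟨Ω, _, w, X, hw, hX⟩ := H
  let t : Ω → T → ℕ := fun a j => X j a
  let X' : ℕ → Ω × Ω → ℕ := fun j p => if j = n then X i p.2 else X j p.1
  let h' : Finset ℕ → ℝ := fun S => weightedEntropy (copyWeight w t) fun p (j : S) => X' j p
  have ht {p : Ω × Ω} (hp : copyWeight w t p ≠ 0) : ∀ j ∈ T, X j p.2 = X j p.1 := fun j hj =>
    congr_fun (copyWeight_ne_zero hp).1 ⟨j, hj⟩
  have hne {S : Finset ℕ} (hS : S ⊆ range n) : ∀ j ∈ S, j ≠ n := fun j hj =>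
    (mem_range.1 (hS hj)).ne
  have hold : ∀ S, S ⊆ range n → h' S = h S := by
    intro S hS
    rw [hX, ← weightedEntropy_copyWeight_fst hw t]
    refine weightedEntropy_congr fun p q _ _ => ?_
    simp only [funext_iff, Subtype.forall, X']
    refine forall₂_congr fun j hj => ?_
    simp [hne hS j hj]
  refine ⟨h', ⟨Ω × Ω, inferInstance, copyWeight w t, X', copyWeight_nonneg hw t, fun S => rfl⟩,
    hold, ?_, ?_⟩
  · intro S hS
    rw [hold _ (insert_subset (mem_range.2 hi) (hS.trans hT)), hX,
      ← weightedEntropy_copyWeight_snd hw t]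
    refine weightedEntropy_congr fun p q hp hq => ?_
    have hp' := ht hp
    have hq' := ht hq
    have hn := hne (hS.trans hT)
    simp only [funext_iff, Subtype.forall, mem_insert, forall_eq_or_imp, X', if_true]
    refine and_congr_right fun _ => forall₂_congr fun j hj => ?_
    rw [if_neg (hn j hj), if_neg (hn j hj), hp' j (hS hj), hq' j (hS hj)]
  · intro R hTR hR
    rw [hold _ hT, hold _ hR, hold _ (insert_subset (mem_range.2 hi) hT)]
    have key : h' (insert n R) = weightedEntropy (copyWeight w t) fun p =>
        ((fun j : R => X j p.1), fun j : (insert i T : Finset ℕ) => X j p.2) := by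
      refine weightedEntropy_congr fun p q hp hq => ?_
      have hp' := ht hp
      have hq' := ht hq
      have hn := hne hR
      simp only [Prod.mk.injEq, funext_iff, Subtype.forall, mem_insert, forall_eq_or_imp, X',
        if_true]
      have hRR : (∀ j ∈ R, (if j = n then X i p.2 else X j p.1) =
          if j = n then X i q.2 else X j q.1) ↔ ∀ j ∈ R, X j p.1 = X j q.1 :=
        forall₂_congr fun j hj => by rw [if_neg (hn j hj), if_neg (hn j hj)]
      rw [hRR]
      constructor
      · rintro ⟨h1, h2⟩
        exact ⟨h2, h1, fun j hj => by rw [hp' j hj, hq' j hj, h2 j (hTR hj)]⟩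
      · rintro ⟨h2, h1, -⟩
        exact ⟨h1, h2⟩
    rw [key, weightedEntropy_copyWeight_pair (f := fun a (j : R) => X j a)
      (g := fun a (j : (insert i T : Finset ℕ)) => X j a) hw, ← hX, ← hX, ← hX]
    · ring
    · intro a b hab
      funext j
      exact congr_fun hab ⟨j, hTR j.2⟩
    · intro a b hab
      funext j
      exact congr_fun hab ⟨j, mem_insert_of_mem j.2⟩

theorem IsEntropic.four_variable_inequality.{u} {h : Finset ℕ → ℝ} (H : IsEntropic.{u} h) :
    -56 * h {1} - 4 * h {2} - 19 * h {3} + 45 * h {1, 2} + 67 * h {1, 3} + 22 * h {2, 3}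
      + 23 * h {1, 4} - 8 * h {2, 4} + 9 * h {3, 4} - 55 * h {1, 2, 3} - 24 * h {1, 3, 4} ≥ 0 := by
  obtain ⟨h₅, H₅, e₅, c₅⟩ := H.exists_copy 5 2 {1, 3} (by decide) (by decide)
  obtain ⟨h₆, H₆, e₆, c₆⟩ := H₅.exists_copy 6 2 {1, 3, 5} (by decide) (by decide)
  obtain ⟨g, G, e₇, c₇⟩ := H₆.exists_copy 7 6 {3, 4, 5} (by decide) (by decide)
  replace c₆ := c₆.congr (m := 7) (by decide) (by decide) (by decide) e₇
  replace c₅ := (c₅.congr (m := 6) (by decide) (by decide) (by decide) e₆).congr (m := 7)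
    (by decide) (by decide) (by decide) e₇
  have hg : ∀ S, S ⊆ range 5 → h S = g S := fun S hS => by
    rw [e₇ S (hS.trans (by decide)), e₆ S (hS.trans (by decide)), e₅ S hS]
  rw [hg {1} (by decide), hg {2} (by decide), hg {3} (by decide),
    hg {1, 2} (by decide), hg {1, 3} (by decide), hg {2, 3} (by decide),
    hg {1, 4} (by decide), hg {2, 4} (by decide), hg {3, 4} (by decide),
    hg {1, 2, 3} (by decide), hg {1, 3, 4} (by decide)]
  have i123456_7 : g {1, 2, 3, 4, 5, 6, 7} + g {3, 4, 5} = g {1, 2, 3, 4, 5, 6} + g {3, 4, 5, 6} :=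
    c₇.add_eq_add {1, 2, 3, 4, 5, 6} (by decide) (by decide) (by decide) (by decide)
  have i2345_7 : g {2, 3, 4, 5, 7} + g {3, 4, 5} = g {2, 3, 4, 5} + g {3, 4, 5, 6} :=
    c₇.add_eq_add {2, 3, 4, 5} (by decide) (by decide) (by decide) (by decide)
  have i1345_7 : g {1, 3, 4, 5, 7} + g {3, 4, 5} = g {1, 3, 4, 5} + g {3, 4, 5, 6} :=
    c₇.add_eq_add {1, 3, 4, 5} (by decide) (by decide) (by decide) (by decide)
  have s345_7 : g {3, 4, 5, 7} = g {3, 4, 5, 6} :=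
    c₇.eq_of_subset {3, 4, 5} (by decide) (by decide) (by decide)
  have s45_7 : g {4, 5, 7} = g {4, 5, 6} :=
    c₇.eq_of_subset {4, 5} (by decide) (by decide) (by decide)
  have s35_7 : g {3, 5, 7} = g {3, 5, 6} :=
    c₇.eq_of_subset {3, 5} (by decide) (by decide) (by decide)
  have s5_7 : g {5, 7} = g {5, 6} :=
    c₇.eq_of_subset {5} (by decide) (by decide) (by decide)
  have i12345_6 : g {1, 2, 3, 4, 5, 6} + g {1, 3, 5} = g {1, 2, 3, 4, 5} + g {1, 2, 3, 5} :=
    c₆.add_eq_add {1, 2, 3, 4, 5} (by decide) (by decide) (by decide) (by decide)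
  have i1345_6 : g {1, 3, 4, 5, 6} + g {1, 3, 5} = g {1, 3, 4, 5} + g {1, 2, 3, 5} :=
    c₆.add_eq_add {1, 3, 4, 5} (by decide) (by decide) (by decide) (by decide)
  have i1235_6 : g {1, 2, 3, 5, 6} + g {1, 3, 5} = g {1, 2, 3, 5} + g {1, 2, 3, 5} :=
    c₆.add_eq_add {1, 2, 3, 5} (by decide) (by decide) (by decide) (by decide)
  have s35_6 : g {3, 5, 6} = g {2, 3, 5} :=
    c₆.eq_of_subset {3, 5} (by decide) (by decide) (by decide)
  have s15_6 : g {1, 5, 6} = g {1, 2, 5} :=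
    c₆.eq_of_subset {1, 5} (by decide) (by decide) (by decide)
  have s5_6 : g {5, 6} = g {2, 5} :=
    c₆.eq_of_subset {5} (by decide) (by decide) (by decide)
  have i1234_5 : g {1, 2, 3, 4, 5} + g {1, 3} = g {1, 2, 3, 4} + g {1, 2, 3} :=
    c₅.add_eq_add {1, 2, 3, 4} (by decide) (by decide) (by decide) (by decide)
  have i134_5 : g {1, 3, 4, 5} + g {1, 3} = g {1, 3, 4} + g {1, 2, 3} :=
    c₅.add_eq_add {1, 3, 4} (by decide) (by decide) (by decide) (by decide)
  have i123_5 : g {1, 2, 3, 5} + g {1, 3} = g {1, 2, 3} + g {1, 2, 3} :=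
    c₅.add_eq_add {1, 2, 3} (by decide) (by decide) (by decide) (by decide)
  have s13_5 : g {1, 3, 5} = g {1, 2, 3} :=
    c₅.eq_of_subset {1, 3} (by decide) (by decide) (by decide)
  have s3_5 : g {3, 5} = g {2, 3} :=
    c₅.eq_of_subset {3} (by decide) (by decide) (by decide)
  have s1_5 : g {1, 5} = g {1, 2} :=
    c₅.eq_of_subset {1} (by decide) (by decide) (by decide)
  have s_5 : g {5} = g {2} :=
    c₅.eq_of_subset ∅ (by decide) (by decide) (by decide)
  have m13_45 : g {1, 3, 4, 5} + g {4, 5} ≤ g {1, 4, 5} + g {3, 4, 5} :=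
    G.submodular {1, 4, 5} {3, 4, 5} (by decide) (by decide)
  have m13_256 : g {1, 2, 3, 5, 6} + g {2, 5, 6} ≤ g {1, 2, 5, 6} + g {2, 3, 5, 6} :=
    G.submodular {1, 2, 5, 6} {2, 3, 5, 6} (by decide) (by decide)
  have m13_456 : g {1, 3, 4, 5, 6} + g {4, 5, 6} ≤ g {1, 4, 5, 6} + g {3, 4, 5, 6} :=
    G.submodular {1, 4, 5, 6} {3, 4, 5, 6} (by decide) (by decide)
  have m13_257 : g {1, 2, 3, 5, 7} + g {2, 5, 7} ≤ g {1, 2, 5, 7} + g {2, 3, 5, 7} :=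
    G.submodular {1, 2, 5, 7} {2, 3, 5, 7} (by decide) (by decide)
  have m14_357 : g {1, 3, 4, 5, 7} + g {3, 5, 7} ≤ g {1, 3, 5, 7} + g {3, 4, 5, 7} :=
    G.submodular {1, 3, 5, 7} {3, 4, 5, 7} (by decide) (by decide)
  have m15_24 : g {1, 2, 4, 5} + g {2, 4} ≤ g {1, 2, 4} + g {2, 4, 5} :=
    G.submodular {1, 2, 4} {2, 4, 5} (by decide) (by decide)
  have m16_245 : g {1, 2, 4, 5, 6} + g {2, 4, 5} ≤ g {1, 2, 4, 5} + g {2, 4, 5, 6} :=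
    G.submodular {1, 2, 4, 5} {2, 4, 5, 6} (by decide) (by decide)
  have m17_35 : g {1, 3, 5, 7} + g {3, 5} ≤ g {1, 3, 5} + g {3, 5, 7} :=
    G.submodular {1, 3, 5} {3, 5, 7} (by decide) (by decide)
  have m17_45 : g {1, 4, 5, 7} + g {4, 5} ≤ g {1, 4, 5} + g {4, 5, 7} :=
    G.submodular {1, 4, 5} {4, 5, 7} (by decide) (by decide)
  have m23_1 : g {1, 2, 3} + g {1} ≤ g {1, 2} + g {1, 3} :=
    G.submodular {1, 2} {1, 3} (by decide) (by decide)
  have m24_5 : g {2, 4, 5} + g {5} ≤ g {2, 5} + g {4, 5} :=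
    G.submodular {2, 5} {4, 5} (by decide) (by decide)
  have m24_56 : g {2, 4, 5, 6} + g {5, 6} ≤ g {2, 5, 6} + g {4, 5, 6} :=
    G.submodular {2, 5, 6} {4, 5, 6} (by decide) (by decide)
  have m24_57 : g {2, 4, 5, 7} + g {5, 7} ≤ g {2, 5, 7} + g {4, 5, 7} :=
    G.submodular {2, 5, 7} {4, 5, 7} (by decide) (by decide)
  have m25_1 : g {1, 2, 5} + g {1} ≤ g {1, 2} + g {1, 5} :=
    G.submodular {1, 2} {1, 5} (by decide) (by decide)
  have m25_3 : g {2, 3, 5} + g {3} ≤ g {2, 3} + g {3, 5} :=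
    G.submodular {2, 3} {3, 5} (by decide) (by decide)
  have m26_15 : g {1, 2, 5, 6} + g {1, 5} ≤ g {1, 2, 5} + g {1, 5, 6} :=
    G.submodular {1, 2, 5} {1, 5, 6} (by decide) (by decide)
  have m26_35 : g {2, 3, 5, 6} + g {3, 5} ≤ g {2, 3, 5} + g {3, 5, 6} :=
    G.submodular {2, 3, 5} {3, 5, 6} (by decide) (by decide)
  have m27_15 : g {1, 2, 5, 7} + g {1, 5} ≤ g {1, 2, 5} + g {1, 5, 7} :=
    G.submodular {1, 2, 5} {1, 5, 7} (by decide) (by decide)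
  have m27_35 : g {2, 3, 5, 7} + g {3, 5} ≤ g {2, 3, 5} + g {3, 5, 7} :=
    G.submodular {2, 3, 5} {3, 5, 7} (by decide) (by decide)
  have m34_15 : g {1, 3, 4, 5} + g {1, 5} ≤ g {1, 3, 5} + g {1, 4, 5} :=
    G.submodular {1, 3, 5} {1, 4, 5} (by decide) (by decide)
  have m34_157 : g {1, 3, 4, 5, 7} + g {1, 5, 7} ≤ g {1, 3, 5, 7} + g {1, 4, 5, 7} :=
    G.submodular {1, 3, 5, 7} {1, 4, 5, 7} (by decide) (by decide)
  have m35_124 : g {1, 2, 3, 4, 5} + g {1, 2, 4} ≤ g {1, 2, 3, 4} + g {1, 2, 4, 5} :=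
    G.submodular {1, 2, 3, 4} {1, 2, 4, 5} (by decide) (by decide)
  have m36_12457 : g {1, 2, 3, 4, 5, 6, 7} + g {1, 2, 4, 5, 7} ≤
      g {1, 2, 3, 4, 5, 7} + g {1, 2, 4, 5, 6, 7} :=
    G.submodular {1, 2, 3, 4, 5, 7} {1, 2, 4, 5, 6, 7} (by decide) (by decide)
  have m37_245 : g {2, 3, 4, 5, 7} + g {2, 4, 5} ≤ g {2, 3, 4, 5} + g {2, 4, 5, 7} :=
    G.submodular {2, 3, 4, 5} {2, 4, 5, 7} (by decide) (by decide)
  have m45_1 : g {1, 4, 5} + g {1} ≤ g {1, 4} + g {1, 5} :=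
    G.submodular {1, 4} {1, 5} (by decide) (by decide)
  have m45_3 : g {3, 4, 5} + g {3} ≤ g {3, 4} + g {3, 5} :=
    G.submodular {3, 4} {3, 5} (by decide) (by decide)
  have m46_15 : g {1, 4, 5, 6} + g {1, 5} ≤ g {1, 4, 5} + g {1, 5, 6} :=
    G.submodular {1, 4, 5} {1, 5, 6} (by decide) (by decide)
  have m47_1235 : g {1, 2, 3, 4, 5, 7} + g {1, 2, 3, 5} ≤ g {1, 2, 3, 4, 5} + g {1, 2, 3, 5, 7} :=
    G.submodular {1, 2, 3, 4, 5} {1, 2, 3, 5, 7} (by decide) (by decide)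
  have m67_1245 : g {1, 2, 4, 5, 6, 7} + g {1, 2, 4, 5} ≤ g {1, 2, 4, 5, 6} + g {1, 2, 4, 5, 7} :=
    G.submodular {1, 2, 4, 5, 6} {1, 2, 4, 5, 7} (by decide) (by decide)
  linarith
end EntropicFunctions

theorem new_inequality_from_H7_first
    {Ω : Type*} [MeasurableSpace Ω] (μ : Measure Ω) [IsProbabilityMeasure μ]
    {α₁ α₂ α₃ α₄ : Type*} [Fintype α₁] [Fintype α₂] [Fintype α₃] [Fintype α₄]
    [MeasurableSpace α₁] [MeasurableSpace α₂] [MeasurableSpace α₃] [MeasurableSpace α₄]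
    [DiscreteMeasurableSpace α₁] [DiscreteMeasurableSpace α₂]
    [DiscreteMeasurableSpace α₃] [DiscreteMeasurableSpace α₄]
    (X₁ : Ω → α₁) (X₂ : Ω → α₂) (X₃ : Ω → α₃) (X₄ : Ω → α₄)
    (hX₁ : Measurable X₁) (hX₂ : Measurable X₂) (hX₃ : Measurable X₃) (hX₄ : Measurable X₄) :
    -56 * shannonEntropy μ X₁
      - 4 * shannonEntropy μ X₂
      - 19 * shannonEntropy μ X₃
      + 45 * shannonEntropy μ (fun ω => (X₁ ω, X₂ ω))
      + 67 * shannonEntropy μ (fun ω => (X₁ ω, X₃ ω))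
      + 22 * shannonEntropy μ (fun ω => (X₂ ω, X₃ ω))
      + 23 * shannonEntropy μ (fun ω => (X₁ ω, X₄ ω))
      - 8 * shannonEntropy μ (fun ω => (X₂ ω, X₄ ω))
      + 9 * shannonEntropy μ (fun ω => (X₃ ω, X₄ ω))
      - 55 * shannonEntropy μ (fun ω => (X₁ ω, X₂ ω, X₃ ω))
      - 24 * shannonEntropy μ (fun ω => (X₁ ω, X₃ ω, X₄ ω)) ≥ 0 := by
  let Y : Ω → α₁ × α₂ × α₃ × α₄ := fun ω => (X₁ ω, X₂ ω, X₃ ω, X₄ ω)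
  have hY : Measurable Y := hX₁.prodMk (hX₂.prodMk (hX₃.prodMk hX₄))
  let w : α₁ × α₂ × α₃ × α₄ → ℝ := fun x => (μ (Y ⁻¹' {x})).toReal
  let X : ℕ → α₁ × α₂ × α₃ × α₄ → ℕ
    | 1, x => Fintype.equivFin α₁ x.1
    | 2, x => Fintype.equivFin α₂ x.2.1
    | 3, x => Fintype.equivFin α₃ x.2.2.1
    | 4, x => Fintype.equivFin α₄ x.2.2.2
    | _, _ => 0
  let h : Finset ℕ → ℝ := fun S => weightedEntropy w fun x (i : S) => X i x
  have H : IsEntropic h := ⟨_, inferInstance, w, X, fun x => ENNReal.toReal_nonneg, fun S => rfl⟩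
  have h1 : shannonEntropy μ X₁ = h {1} :=
    shannonEntropy_comp_eq_of_iff μ hY X _ (fun x => x.1) (by simp [X, Fin.val_inj])
  have h2 : shannonEntropy μ X₂ = h {2} :=
    shannonEntropy_comp_eq_of_iff μ hY X _ (fun x => x.2.1) (by simp [X, Fin.val_inj])
  have h3 : shannonEntropy μ X₃ = h {3} :=
    shannonEntropy_comp_eq_of_iff μ hY X _ (fun x => x.2.2.1) (by simp [X, Fin.val_inj])
  have h12 : shannonEntropy μ (fun ω => (X₁ ω, X₂ ω)) = h {1, 2} :=
    shannonEntropy_comp_eq_of_iff μ hY X _ (fun x => (x.1, x.2.1)) (by simp [X, Fin.val_inj])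
  have h13 : shannonEntropy μ (fun ω => (X₁ ω, X₃ ω)) = h {1, 3} :=
    shannonEntropy_comp_eq_of_iff μ hY X _ (fun x => (x.1, x.2.2.1)) (by simp [X, Fin.val_inj])
  have h23 : shannonEntropy μ (fun ω => (X₂ ω, X₃ ω)) = h {2, 3} :=
    shannonEntropy_comp_eq_of_iff μ hY X _ (fun x => (x.2.1, x.2.2.1)) (by simp [X, Fin.val_inj])
  have h14 : shannonEntropy μ (fun ω => (X₁ ω, X₄ ω)) = h {1, 4} :=
    shannonEntropy_comp_eq_of_iff μ hY X _ (fun x => (x.1, x.2.2.2)) (by simp [X, Fin.val_inj])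
  have h24 : shannonEntropy μ (fun ω => (X₂ ω, X₄ ω)) = h {2, 4} :=
    shannonEntropy_comp_eq_of_iff μ hY X _ (fun x => (x.2.1, x.2.2.2)) (by simp [X, Fin.val_inj])
  have h34 : shannonEntropy μ (fun ω => (X₃ ω, X₄ ω)) = h {3, 4} :=
    shannonEntropy_comp_eq_of_iff μ hY X _ (fun x => (x.2.2.1, x.2.2.2)) (by simp [X, Fin.val_inj])
  have h123 : shannonEntropy μ (fun ω => (X₁ ω, X₂ ω, X₃ ω)) = h {1, 2, 3} :=
    shannonEntropy_comp_eq_of_iff μ hY X _ (fun x => (x.1, x.2.1, x.2.2.1))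
      (by simp [X, Fin.val_inj])
  have h134 : shannonEntropy μ (fun ω => (X₁ ω, X₃ ω, X₄ ω)) = h {1, 3, 4} :=
    shannonEntropy_comp_eq_of_iff μ hY X _ (fun x => (x.1, x.2.2.1, x.2.2.2))
      (by simp [X, Fin.val_inj])
  rw [h1, h2, h3, h12, h13, h23, h14, h24, h34, h123, h134]
  exact H.four_variable_inequality
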